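/- arXiv:2406.11508 — 5 statements merged into one kernel-verified Lean document; each statement's English description precedes it below -/
import Mathlib

section
/- Head-to-tail transfer function of the mixed platoon (Lemma 1, algebraic form): suppose complex numbers V_d, S_H, V_H, S_j, V_j (j = 1,…,N), S_T, V_T satisfy the Laplace-domain linearized dynamics: s·S_H = V_d − V_H; s·V_H = ξ_H·S_H − η_H·V_H + β_{H,d}·V_d + Σ_{i∈𝒩_H} β_{H,i}·V_i + β_{H,T}·V_T; for every j = 1,…,N (with V_0 := V_H): s·S_j = V_{j−1} − V_j and s·V_j = a_{j1}·S_j − a_{j2}·V_j + a_{j3}·V_{j−1}; s·S_T = V_N − V_T; and s·V_T = ξ_T·S_T − η_T·V_T + β_{T,N}·V_N + Σ_{i∈𝒩_T} β_{T,i}·V_i + β_{T,H}·V_H. If s² + a_{j2}·s + a_{j1} ≠ 0 for every j = 1,…,N, then D(s)·V_T = N(s)·V_d; that is, whenever D(s) ≠ 0 the head-to-tail transfer function is G(s) = V_T/V_d = N(s)/D(s). -/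
open Finset

/-- `P_i(s) = ∏_{j=1}^{i} (a_{j3} s + a_{j1}) * ∏_{j=i+1}^{N} (s² + a_{j2} s + a_{j1})`. -/
noncomputable def Ppoly (N : ℕ) (a1 a2 a3 : ℕ → ℂ) (s : ℂ) (i : ℕ) : ℂ :=
  (∏ j ∈ Finset.Icc 1 i, (a3 j * s + a1 j)) *
    ∏ j ∈ Finset.Icc (i + 1) N, (s ^ 2 + a2 j * s + a1 j)

/-- `R(s) = β_{T,H} s P_0(s) + (β_{T,N} s + ξ_T) P_N(s) + Σ_{i∈𝒩_T} β_{T,i} s P_i(s)`. -/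
noncomputable def Rfun (N : ℕ) (a1 a2 a3 : ℕ → ℂ) (𝒩T : Finset ℕ)
    (ξT βTN βTH : ℂ) (βT : ℕ → ℂ) (s : ℂ) : ℂ :=
  βTH * s * Ppoly N a1 a2 a3 s 0 + (βTN * s + ξT) * Ppoly N a1 a2 a3 s N
    + ∑ i ∈ 𝒩T, βT i * s * Ppoly N a1 a2 a3 s i

/-- Numerator `N(s) = (β_{H,d} s + ξ_H) · R(s)` of the head-to-tail transfer function. -/
noncomputable def Nnum (N : ℕ) (a1 a2 a3 : ℕ → ℂ) (𝒩T : Finset ℕ)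
    (ξH βHd ξT βTN βTH : ℂ) (βT : ℕ → ℂ) (s : ℂ) : ℂ :=
  (βHd * s + ξH) * Rfun N a1 a2 a3 𝒩T ξT βTN βTH βT s

/-- Denominator `D(s)` of the head-to-tail transfer function. -/
noncomputable def Dden (N : ℕ) (a1 a2 a3 : ℕ → ℂ) (𝒩H 𝒩T : Finset ℕ)
    (ξH ηH βHT ξT ηT βTN βTH : ℂ) (βH βT : ℕ → ℂ) (s : ℂ) : ℂ :=
  ((s ^ 2 + ηH * s + ξH) * Ppoly N a1 a2 a3 s 0
      - ∑ i ∈ 𝒩H, βH i * s * Ppoly N a1 a2 a3 s i) * (s ^ 2 + ηT * s + ξT)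
    - βHT * s * Rfun N a1 a2 a3 𝒩T ξT βTN βTH βT s

/-- Head-to-tail transfer function of the mixed platoon (Lemma 1,
algebraic form): the Laplace-domain linearized dynamics imply `D(s)·V_T = N(s)·V_d`;
in particular, whenever `D(s) ≠ 0`, `V_T / V_d = N(s) / D(s)`.
Here `V 0` denotes the head CAV's speed perturbation transform `V_H`. -/
theorem head_to_tail_transfer_function
    (N : ℕ) (hN : 1 ≤ N) (s : ℂ) (a1 a2 a3 : ℕ → ℂ)
    (𝒩H : Finset ℕ) (h𝒩H : 𝒩H ⊆ Finset.Icc 1 N)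
    (𝒩T : Finset ℕ) (h𝒩T : 𝒩T ⊆ Finset.Icc 1 (N - 1))
    (ξH ηH βHd βHT ξT ηT βTN βTH : ℂ) (βH βT : ℕ → ℂ)
    (Vd SH ST VT : ℂ) (S V : ℕ → ℂ)
    -- head CAV dynamics (with V 0 = V_H):
    (hSH : s * SH = Vd - V 0)
    (hVH : s * V 0 = ξH * SH - ηH * V 0 + βHd * Vd
      + (∑ i ∈ 𝒩H, βH i * V i) + βHT * VT)
    -- middle HV dynamics:
    (hHVgap : ∀ j ∈ Finset.Icc 1 N, s * S j = V (j - 1) - V j)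
    (hHVspeed : ∀ j ∈ Finset.Icc 1 N,
      s * V j = a1 j * S j - a2 j * V j + a3 j * V (j - 1))
    -- tail CAV dynamics:
    (hST : s * ST = V N - VT)
    (hVT : s * VT = ξT * ST - ηT * VT + βTN * V N
      + (∑ i ∈ 𝒩T, βT i * V i) + βTH * V 0)
    -- nondegeneracy of the HV characteristic factors:
    (hnz : ∀ j ∈ Finset.Icc 1 N, s ^ 2 + a2 j * s + a1 j ≠ 0) :
    Dden N a1 a2 a3 𝒩H 𝒩T ξH ηH βHT ξT ηT βTN βTH βH βT s * VT
      = Nnum N a1 a2 a3 𝒩T ξH βHd ξT βTN βTH βT s * Vd ∧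
    (Dden N a1 a2 a3 𝒩H 𝒩T ξH ηH βHT ξT ηT βTN βTH βH βT s ≠ 0 → Vd ≠ 0 →
      VT / Vd = Nnum N a1 a2 a3 𝒩T ξH βHd ξT βTN βTH βT s
        / Dden N a1 a2 a3 𝒩H 𝒩T ξH ηH βHT ξT ηT βTN βTH βH βT s) := by
  have hP0 : Ppoly N a1 a2 a3 s 0 ≠ 0 := by
    unfold Ppoly
    simp only [zero_add]
    refine mul_ne_zero (by simp) (Finset.prod_ne_zero_iff.mpr hnz)
  have hrec : ∀ i, i + 1 ≤ N → (s ^ 2 + a2 (i+1) * s + a1 (i+1)) * Ppoly N a1 a2 a3 s (i+1)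
      = (a3 (i+1) * s + a1 (i+1)) * Ppoly N a1 a2 a3 s i := by
    intro i hi
    unfold Ppoly
    rw [Finset.prod_Icc_succ_top (by omega : 1 ≤ i + 1),
      ← Finset.insert_Icc_add_one_left_eq_Icc hi, Finset.prod_insert (by simp)]
    ring
  obtain ⟨c, hc0⟩ : ∃ c, V 0 = c * Ppoly N a1 a2 a3 s 0 :=
    ⟨V 0 / Ppoly N a1 a2 a3 s 0, by field_simp⟩
  have hc : ∀ i, i ≤ N → V i = c * Ppoly N a1 a2 a3 s i := by
    intro i
    induction i with
    | zero => intro _; exact hc0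
    | succ k ih =>
      intro hk
      have hm : k + 1 ∈ Finset.Icc 1 N := Finset.mem_Icc.mpr ⟨by omega, hk⟩
      have h1 := hHVgap _ hm
      have h2 := hHVspeed _ hm
      have h3 := ih (by omega)
      simp only [Nat.add_sub_cancel] at h1 h2
      apply mul_left_cancel₀ (hnz _ hm)
      linear_combination s * h2 + a1 (k+1) * h1 + (a3 (k+1) * s + a1 (k+1)) * h3 - c * hrec k hk
  have hsH : s * ∑ i ∈ 𝒩H, βH i * V i = c * ∑ i ∈ 𝒩H, βH i * s * Ppoly N a1 a2 a3 s i := by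
    rw [Finset.mul_sum, Finset.mul_sum]
    refine Finset.sum_congr rfl fun i hi => ?_
    rw [hc i (Finset.mem_Icc.mp (h𝒩H hi)).2]
    ring
  have hsT : s * ∑ i ∈ 𝒩T, βT i * V i = c * ∑ i ∈ 𝒩T, βT i * s * Ppoly N a1 a2 a3 s i := by
    rw [Finset.mul_sum, Finset.mul_sum]
    refine Finset.sum_congr rfl fun i hi => ?_
    rw [hc i ((Finset.mem_Icc.mp (h𝒩T hi)).2.trans (Nat.sub_le _ _))]
    ring
  have hA : ((s ^ 2 + ηH * s + ξH) * Ppoly N a1 a2 a3 s 0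
      - ∑ i ∈ 𝒩H, βH i * s * Ppoly N a1 a2 a3 s i) * c
      = (βHd * s + ξH) * Vd + βHT * s * VT := by
    linear_combination s * hVH + ξH * hSH + hsH - (s ^ 2 + ηH * s + ξH) * hc0
  have hB : (s ^ 2 + ηT * s + ξT) * VT = Rfun N a1 a2 a3 𝒩T ξT βTN βTH βT s * c := by
    unfold Rfun
    linear_combination s * hVT + ξT * hST + hsT + (βTN * s + ξT) * hc N le_rfl + βTH * s * hc0
  have key : Dden N a1 a2 a3 𝒩H 𝒩T ξH ηH βHT ξT ηT βTN βTH βH βT s * VT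
      = Nnum N a1 a2 a3 𝒩T ξH βHd ξT βTN βTH βT s * Vd := by
    unfold Dden Nnum
    linear_combination ((s ^ 2 + ηH * s + ξH) * Ppoly N a1 a2 a3 s 0
      - ∑ i ∈ 𝒩H, βH i * s * Ppoly N a1 a2 a3 s i) * hB
      + Rfun N a1 a2 a3 𝒩T ξT βTN βTH βT s * hA
  refine ⟨key, fun hD hV => ?_⟩
  rw [div_eq_div_iff hV hD]
  linear_combination key
end

section
/- Existence of the limit defining the string-stability boundary: if all the coefficients a_{j1}, a_{j2}, a_{j3}, ξ_H, η_H, β_{H,d}, β_{H,T}, β_{H,i}, ξ_T, η_T, β_{T,N}, β_{T,H}, β_{T,i} are real, then there exists a polynomial q with real coefficients such that |D(iω)|² − |N(iω)|² = ω²·q(ω²) for every real ω (where i is the imaginary unit). In particular, the limit lim_{ω→0⁺} (|D(iω)|² − |N(iω)|²)/ω² exists and equals q(0). -/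
open Finset

/-- `f(iω) = A(ω²) + B(ω²) iω` for real polynomials `A`, `B`. -/
def EvenOdd (f : ℂ → ℂ) : Prop :=
  ∃ A B : Polynomial ℝ, ∀ ω : ℝ, f ((ω : ℂ) * Complex.I)
    = ((A.eval (ω ^ 2) : ℝ) : ℂ) + ((B.eval (ω ^ 2) : ℝ) : ℂ) * ((ω : ℂ) * Complex.I)

theorem EvenOdd.const (c : ℝ) : EvenOdd (fun _ => (c : ℂ)) :=
  ⟨Polynomial.C c, 0, fun ω => by simp⟩

theorem EvenOdd.var : EvenOdd (fun s => s) :=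
  ⟨0, 1, fun ω => by simp⟩

theorem EvenOdd.plus {f g : ℂ → ℂ} (hf : EvenOdd f) (hg : EvenOdd g) :
    EvenOdd (fun s => f s + g s) := by
  obtain ⟨A, B, h⟩ := hf
  obtain ⟨A', B', h'⟩ := hg
  refine ⟨A + A', B + B', fun ω => ?_⟩
  simp only [h, h', Polynomial.eval_add, Complex.ofReal_add]
  ring

theorem EvenOdd.times {f g : ℂ → ℂ} (hf : EvenOdd f) (hg : EvenOdd g) :
    EvenOdd (fun s => f s * g s) := by
  obtain ⟨A, B, h⟩ := hf
  obtain ⟨A', B', h'⟩ := hg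
  refine ⟨A * A' - Polynomial.X * B * B', A * B' + B * A', fun ω => ?_⟩
  simp only [h, h', Polynomial.eval_add, Polynomial.eval_sub, Polynomial.eval_mul,
    Polynomial.eval_X, Complex.ofReal_add, Complex.ofReal_sub, Complex.ofReal_mul,
    Complex.ofReal_pow]
  linear_combination ((B.eval (ω ^ 2) : ℝ) : ℂ) * ((B'.eval (ω ^ 2) : ℝ) : ℂ) * (ω : ℂ) ^ 2
    * Complex.I_sq

theorem EvenOdd.minus {f g : ℂ → ℂ} (hf : EvenOdd f) (hg : EvenOdd g) :
    EvenOdd (fun s => f s - g s) := by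
  have h := hf.plus ((EvenOdd.const (-1)).times hg)
  simpa [sub_eq_add_neg] using h

theorem EvenOdd.square : EvenOdd (fun s => s ^ 2) := by
  simpa [pow_two] using EvenOdd.var.times EvenOdd.var

theorem EvenOdd.fsum (S : Finset ℕ) (f : ℕ → ℂ → ℂ) (hf : ∀ i, EvenOdd (f i)) :
    EvenOdd (fun s => ∑ i ∈ S, f i s) := by
  classical
  induction S using Finset.induction_on with
  | empty => simpa using EvenOdd.const 0
  | insert a S ha ih => simpa [Finset.sum_insert ha] using (hf a).plus ih

theorem EvenOdd.fprod (S : Finset ℕ) (f : ℕ → ℂ → ℂ) (hf : ∀ i, EvenOdd (f i)) :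
    EvenOdd (fun s => ∏ i ∈ S, f i s) := by
  classical
  induction S using Finset.induction_on with
  | empty => simpa using EvenOdd.const 1
  | insert a S ha ih => simpa [Finset.prod_insert ha] using (hf a).times ih

theorem EvenOdd.quad (b c : ℝ) : EvenOdd (fun s => s ^ 2 + (b : ℂ) * s + (c : ℂ)) :=
  (EvenOdd.square.plus ((EvenOdd.const b).times EvenOdd.var)).plus (EvenOdd.const c)

theorem EvenOdd.lin (b c : ℝ) : EvenOdd (fun s => (b : ℂ) * s + (c : ℂ)) :=
  ((EvenOdd.const b).times EvenOdd.var).plus (EvenOdd.const c)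

theorem EvenOdd.P (N : ℕ) (a1 a2 a3 : ℕ → ℝ) (i : ℕ) :
    EvenOdd (fun s => Ppoly N (fun j => (a1 j : ℂ)) (fun j => (a2 j : ℂ))
      (fun j => (a3 j : ℂ)) s i) :=
  (EvenOdd.fprod _ _ fun j => EvenOdd.lin (a3 j) (a1 j)).times
    (EvenOdd.fprod _ _ fun j => EvenOdd.quad (a2 j) (a1 j))

theorem EvenOdd.sP (N : ℕ) (a1 a2 a3 : ℕ → ℝ) (b : ℝ) (i : ℕ) :
    EvenOdd (fun s => (b : ℂ) * s * Ppoly N (fun j => (a1 j : ℂ)) (fun j => (a2 j : ℂ))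
      (fun j => (a3 j : ℂ)) s i) :=
  ((EvenOdd.const b).times EvenOdd.var).times (EvenOdd.P N a1 a2 a3 i)

theorem EvenOdd.R (N : ℕ) (a1 a2 a3 : ℕ → ℝ) (T : Finset ℕ) (ξT βTN βTH : ℝ) (βT : ℕ → ℝ) :
    EvenOdd (fun s => Rfun N (fun j => (a1 j : ℂ)) (fun j => (a2 j : ℂ))
      (fun j => (a3 j : ℂ)) T (ξT : ℂ) (βTN : ℂ) (βTH : ℂ) (fun i => (βT i : ℂ)) s) :=
  ((EvenOdd.sP N a1 a2 a3 βTH 0).plus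
    ((EvenOdd.lin βTN ξT).times (EvenOdd.P N a1 a2 a3 N))).plus
    (EvenOdd.fsum _ _ fun i => EvenOdd.sP N a1 a2 a3 (βT i) i)

theorem EvenOdd.main {f g : ℂ → ℂ} (hf : EvenOdd f) (hg : EvenOdd g) (h0 : f 0 = g 0) :
    ∃ q : Polynomial ℝ,
      (∀ ω : ℝ, norm (f ((ω : ℂ) * Complex.I)) ^ 2 - norm (g ((ω : ℂ) * Complex.I)) ^ 2
        = ω ^ 2 * q.eval (ω ^ 2)) ∧
      Filter.Tendsto (fun ω : ℝ =>
        (norm (f ((ω : ℂ) * Complex.I)) ^ 2 - norm (g ((ω : ℂ) * Complex.I)) ^ 2) / ω ^ 2)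
        (nhdsWithin 0 (Set.Ioi 0)) (nhds (q.eval 0)) := by
  obtain ⟨A, B, h⟩ := hf
  obtain ⟨A', B', h'⟩ := hg
  have nrm : ∀ a b ω : ℝ, norm ((a : ℂ) + (b : ℂ) * ((ω : ℂ) * Complex.I)) ^ 2
      = a ^ 2 + ω ^ 2 * b ^ 2 := by
    intro a b ω
    rw [← Complex.normSq_eq_norm_sq, Complex.normSq_apply]
    simp
    ring
  have hA : A.eval 0 = A'.eval 0 := by
    have e := h 0
    have e' := h' 0
    simp only [Complex.ofReal_zero, zero_mul, mul_zero, add_zero, ne_eq, OfNat.ofNat_ne_zero,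
      not_false_eq_true, zero_pow] at e e'
    rw [e, e'] at h0
    exact_mod_cast h0
  have hdvd : Polynomial.X ∣ A ^ 2 - A' ^ 2 := by
    rw [Polynomial.X_dvd_iff, Polynomial.coeff_zero_eq_eval_zero]
    simp [hA]
  obtain ⟨p, hp⟩ := hdvd
  have key : ∀ ω : ℝ, norm (f ((ω : ℂ) * Complex.I)) ^ 2 - norm (g ((ω : ℂ) * Complex.I)) ^ 2
        = ω ^ 2 * (p + B ^ 2 - B' ^ 2).eval (ω ^ 2) := by
    intro ω
    rw [h, h', nrm, nrm]
    have := congrArg (Polynomial.eval (ω ^ 2)) hp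
    simp only [Polynomial.eval_sub, Polynomial.eval_pow, Polynomial.eval_mul,
      Polynomial.eval_X, Polynomial.eval_add] at this ⊢
    linear_combination this
  refine ⟨p + B ^ 2 - B' ^ 2, key, ?_⟩
  generalize p + B ^ 2 - B' ^ 2 = q at key ⊢
  have hc : Continuous (fun ω : ℝ => q.eval (ω ^ 2)) := q.continuous.comp (continuous_pow 2)
  have ht : Filter.Tendsto (fun ω : ℝ => q.eval (ω ^ 2)) (nhdsWithin 0 (Set.Ioi 0))
      (nhds (q.eval 0)) := by
    have := (hc.tendsto 0).mono_left (nhdsWithin_le_nhds (s := Set.Ioi 0))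
    simpa using this
  refine ht.congr' ?_
  filter_upwards [self_mem_nhdsWithin] with ω hω
  have : ω ≠ 0 := ne_of_gt hω
  rw [key]
  field_simp

/-- existence of the limit defining the string-stability boundary.
If all coefficients are real, there is a real polynomial `q` with
`|D(iω)|² − |N(iω)|² = ω² q(ω²)` for all real `ω`; in particular the limit of
`(|D(iω)|² − |N(iω)|²)/ω²` as `ω → 0⁺` exists and equals `q(0)`. -/
theorem string_stability_boundary_limit
    (N : ℕ) (hN : 1 ≤ N) (a1 a2 a3 : ℕ → ℝ)
    (𝒩H : Finset ℕ) (h𝒩H : 𝒩H ⊆ Finset.Icc 1 N)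
    (𝒩T : Finset ℕ) (h𝒩T : 𝒩T ⊆ Finset.Icc 1 (N - 1))
    (ξH ηH βHd βHT ξT ηT βTN βTH : ℝ) (βH βT : ℕ → ℝ) :
    ∃ q : Polynomial ℝ,
      (∀ ω : ℝ,
        (norm (Dden N (fun j => (a1 j : ℂ)) (fun j => (a2 j : ℂ))
            (fun j => (a3 j : ℂ)) 𝒩H 𝒩T (ξH : ℂ) (ηH : ℂ) (βHT : ℂ) (ξT : ℂ)
            (ηT : ℂ) (βTN : ℂ) (βTH : ℂ) (fun i => (βH i : ℂ))
            (fun i => (βT i : ℂ)) ((ω : ℂ) * Complex.I))) ^ 2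
          - (norm (Nnum N (fun j => (a1 j : ℂ)) (fun j => (a2 j : ℂ))
            (fun j => (a3 j : ℂ)) 𝒩T (ξH : ℂ) (βHd : ℂ) (ξT : ℂ) (βTN : ℂ)
            (βTH : ℂ) (fun i => (βT i : ℂ)) ((ω : ℂ) * Complex.I))) ^ 2
          = ω ^ 2 * q.eval (ω ^ 2)) ∧
      Filter.Tendsto (fun ω : ℝ =>
          ((norm (Dden N (fun j => (a1 j : ℂ)) (fun j => (a2 j : ℂ))
            (fun j => (a3 j : ℂ)) 𝒩H 𝒩T (ξH : ℂ) (ηH : ℂ) (βHT : ℂ) (ξT : ℂ)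
            (ηT : ℂ) (βTN : ℂ) (βTH : ℂ) (fun i => (βH i : ℂ))
            (fun i => (βT i : ℂ)) ((ω : ℂ) * Complex.I))) ^ 2
          - (norm (Nnum N (fun j => (a1 j : ℂ)) (fun j => (a2 j : ℂ))
            (fun j => (a3 j : ℂ)) 𝒩T (ξH : ℂ) (βHd : ℂ) (ξT : ℂ) (βTN : ℂ)
            (βTH : ℂ) (fun i => (βT i : ℂ)) ((ω : ℂ) * Complex.I))) ^ 2) / ω ^ 2)
        (nhdsWithin 0 (Set.Ioi 0)) (nhds (q.eval 0)) := by
  have hR := EvenOdd.R N a1 a2 a3 𝒩T ξT βTN βTH βT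
  refine EvenOdd.main (f := fun s => Dden N (fun j => (a1 j : ℂ)) (fun j => (a2 j : ℂ))
            (fun j => (a3 j : ℂ)) 𝒩H 𝒩T (ξH : ℂ) (ηH : ℂ) (βHT : ℂ) (ξT : ℂ)
            (ηT : ℂ) (βTN : ℂ) (βTH : ℂ) (fun i => (βH i : ℂ))
            (fun i => (βT i : ℂ)) s)
    (g := fun s => Nnum N (fun j => (a1 j : ℂ)) (fun j => (a2 j : ℂ))
            (fun j => (a3 j : ℂ)) 𝒩T (ξH : ℂ) (βHd : ℂ) (ξT : ℂ) (βTN : ℂ)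
            (βTH : ℂ) (fun i => (βT i : ℂ)) s) ?_ ?_ ?_
  · exact ((((EvenOdd.quad ηH ξH).times (EvenOdd.P N a1 a2 a3 0)).minus
      (EvenOdd.fsum _ _ fun i => EvenOdd.sP N a1 a2 a3 (βH i) i)).times
      (EvenOdd.quad ηT ξT)).minus (((EvenOdd.const βHT).times EvenOdd.var).times hR)
  · exact (EvenOdd.lin βHd ξH).times hR
  · simp [Dden, Nnum, Rfun, Ppoly]
    ring
end

section
/- Theorem 2 (safety of the nominal head CAV controller, Nagumo condition form): assume κ ≤ 1/τ_H and α_H ≥ (|1 − τ_H·β_{H,d}| + τ_H·Σ_{i∈𝒩_H}|β_{H,i}| + τ_H·|β_{H,T}|)·v_max/s_st. Then for all speeds v_d, v_H, v_T ∈ [0, v_max], all speeds v_i ∈ [0, v_max] (i ∈ 𝒩_H), and every gap s_H ∈ [s_st, s_go] lying on the safety boundary, i.e. s_H = τ_H·v_H, one has v_d − v_H − τ_H·k_{H,n} ≥ 0. In other words, the derivative of the safety function h_H = s_H − τ_H·v_H along the closed-loop dynamics ṡ_H = v_d − v_H, v̇_H = k_{H,n} is nonnegative whenever h_H = 0, which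 is the Nagumo condition rendering the safe set {h_H ≥ 0} forward invariant. -/
/-- Range policy `V(s)`: `0` for `s ≤ s_st`, `κ (s − s_st)` for `s_st < s < s_go`,
and `v_max` for `s ≥ s_go`, with `κ = v_max / (s_go − s_st)`. -/
noncomputable def rangePolicy (sst sgo vmax : ℝ) (s : ℝ) : ℝ :=
  if s ≤ sst then 0
  else if s < sgo then (vmax / (sgo - sst)) * (s - sst)
  else vmax

/-- Theorem 2, Nagumo condition form: safety of the nominal head CAV
controller. Under `κ ≤ 1/τ_H` and the gain condition on `α_H`, on the safety
boundary `s_H = τ_H v_H` the derivative `v_d − v_H − τ_H k_{H,n}` of the safety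
function `h_H = s_H − τ_H v_H` is nonnegative. -/
theorem nominal_head_cav_controller_safety
    (sst sgo vmax τH : ℝ) (hsst : 0 < sst) (hss : sst < sgo) (hvmax : 0 < vmax)
    (hτH : 0 < τH)
    (𝒩H : Finset ℕ) (αH βHd βHT : ℝ) (βH : ℕ → ℝ)
    (hκ : vmax / (sgo - sst) ≤ 1 / τH)
    (hα : αH ≥ (|1 - τH * βHd| + τH * (∑ i ∈ 𝒩H, |βH i|) + τH * |βHT|)
      * vmax / sst) :
    ∀ (vd vH vT : ℝ) (vi : ℕ → ℝ),
      vd ∈ Set.Icc 0 vmax → vH ∈ Set.Icc 0 vmax → vT ∈ Set.Icc 0 vmax →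
      (∀ i ∈ 𝒩H, vi i ∈ Set.Icc 0 vmax) →
      ∀ sH ∈ Set.Icc sst sgo, sH = τH * vH →
      vd - vH - τH * (αH * (rangePolicy sst sgo vmax sH - vH)
          + βHd * (min vd vmax - vH)
          + (∑ i ∈ 𝒩H, βH i * (min (vi i) vmax - vH))
          + βHT * (min vT vmax - vH)) ≥ 0 := by
  intro vd vH vT vi hd hH hT hi sH hs hb
  have key : ∀ b x : ℝ, x ∈ Set.Icc 0 vmax → b * (x - vH) ≤ |b| * vmax := by
    intro b x hx
    have h1 : |x - vH| ≤ vmax := by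
      rw [abs_le]
      constructor <;> linarith [hx.1, hx.2, hH.1, hH.2]
    calc b * (x - vH) ≤ |b * (x - vH)| := le_abs_self _
      _ = |b| * |x - vH| := abs_mul _ _
      _ ≤ |b| * vmax := mul_le_mul_of_nonneg_left h1 (abs_nonneg _)
  have hpos : 0 < sgo - sst := sub_pos.2 hss
  have hV : rangePolicy sst sgo vmax sH = (vmax / (sgo - sst)) * (sH - sst) := by
    unfold rangePolicy
    split_ifs with h1 h2
    · have : sH = sst := le_antisymm h1 hs.1
      rw [this]; ring
    · rfl
    · have : sH = sgo := le_antisymm hs.2 (not_lt.1 h2)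
      rw [this]; field_simp
  have hκ' : (vmax / (sgo - sst)) * τH ≤ 1 := (le_div_iff₀ hτH).1 hκ
  have hgap : sst ≤ τH * (vH - rangePolicy sst sgo vmax sH) := by
    rw [hV]
    have := mul_le_mul_of_nonneg_right hκ' (sub_nonneg.2 hs.1)
    nlinarith
  have hS : 0 ≤ ∑ i ∈ 𝒩H, |βH i| := Finset.sum_nonneg fun i _ => abs_nonneg _
  have hα0 : 0 ≤ αH := le_trans (by positivity) hα
  have hα1 := (div_le_iff₀ hsst).1 hα
  have hα2 := mul_le_mul_of_nonneg_left hgap hα0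
  have hsum : ∑ i ∈ 𝒩H, βH i * (min (vi i) vmax - vH) ≤ (∑ i ∈ 𝒩H, |βH i|) * vmax := by
    rw [Finset.sum_mul]
    refine Finset.sum_le_sum fun i h => ?_
    rw [min_eq_left (hi i h).2]
    exact key _ _ (hi i h)
  have hsum' := mul_le_mul_of_nonneg_left hsum hτH.le
  have hT' := mul_le_mul_of_nonneg_left (key βHT vT hT) hτH.le
  have hd' := key (-(1 - τH * βHd)) vd hd
  rw [abs_neg] at hd'
  rw [min_eq_left hd.2, min_eq_left hT.2]
  linarith
end

section
/- Theorem 3 (safety of the nominal tail CAV controller, Nagumo condition form): assume κ ≤ 1/τ_T and α_T ≥ (|1 − τ_T·β_{T,N}| + τ_T·Σ_{i∈𝒩_T}|β_{T,i}| + τ_T·|β_{T,H}|)·v_max/s_st. Then for all speeds v_N, v_T, v_H ∈ [0, v_max], all speeds v_i ∈ [0, v_max] (i ∈ 𝒩_T), and every gap s_T ∈ [s_st, s_go] lying on the safety boundary, i.e. s_T = τ_T·v_T, one has v_N − v_T − τ_T·k_{T,n} ≥ 0. In other words, the derivative of the safety function h_T = s_T − τ_T·v_T along the closed-loop dynamics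 ṡ_T = v_N − v_T, v̇_T = k_{T,n} is nonnegative whenever h_T = 0, which is the Nagumo condition rendering the safe set {h_T ≥ 0} forward invariant. -/
/-- Theorem 3, Nagumo condition form: safety of the nominal tail CAV
controller. Under `κ ≤ 1/τ_T` and the gain condition on `α_T`, on the safety
boundary `s_T = τ_T v_T` the derivative `v_N − v_T − τ_T k_{T,n}` of the safety
function `h_T = s_T − τ_T v_T` is nonnegative. -/
theorem nominal_tail_cav_controller_safety
    (sst sgo vmax τT : ℝ) (hsst : 0 < sst) (hss : sst < sgo) (hvmax : 0 < vmax)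
    (hτT : 0 < τT)
    (𝒩T : Finset ℕ) (αT βTN βTH : ℝ) (βT : ℕ → ℝ)
    (hκ : vmax / (sgo - sst) ≤ 1 / τT)
    (hα : αT ≥ (|1 - τT * βTN| + τT * (∑ i ∈ 𝒩T, |βT i|) + τT * |βTH|)
      * vmax / sst) :
    ∀ (vN vT vH : ℝ) (vi : ℕ → ℝ),
      vN ∈ Set.Icc 0 vmax → vT ∈ Set.Icc 0 vmax → vH ∈ Set.Icc 0 vmax →
      (∀ i ∈ 𝒩T, vi i ∈ Set.Icc 0 vmax) →
      ∀ sT ∈ Set.Icc sst sgo, sT = τT * vT →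
      vN - vT - τT * (αT * (rangePolicy sst sgo vmax sT - vT)
          + βTN * (min vN vmax - vT)
          + (∑ i ∈ 𝒩T, βT i * (min (vi i) vmax - vT))
          + βTH * (min vH vmax - vT)) ≥ 0 := by
  intro vN vT vH vi hN hT hH hi sT hs hsT
  have hgap : 0 < sgo - sst := by linarith
  have hV : rangePolicy sst sgo vmax sT = vmax / (sgo - sst) * (sT - sst) := by
    unfold rangePolicy
    split_ifs with h1 h2
    · have : sT = sst := le_antisymm h1 hs.1
      simp [this]
    · rfl
    · have : sT = sgo := le_antisymm hs.2 (not_lt.mp h2)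
      rw [this]
      field_simp
  have hprod : ∀ b v : ℝ, v ∈ Set.Icc 0 vmax → b * (v - vT) ≤ |b| * vmax := by
    intro b v hv
    have h1 : |v - vT| ≤ vmax := by
      rw [abs_le]
      constructor <;> linarith [hv.1, hv.2, hT.1, hT.2]
    calc b * (v - vT) ≤ |b * (v - vT)| := le_abs_self _
      _ = |b| * |v - vT| := abs_mul _ _
      _ ≤ |b| * vmax := mul_le_mul_of_nonneg_left h1 (abs_nonneg b)
  have hsum : (∑ i ∈ 𝒩T, βT i * (min (vi i) vmax - vT)) ≤ (∑ i ∈ 𝒩T, |βT i|) * vmax := by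
    rw [Finset.sum_mul]
    apply Finset.sum_le_sum
    intro i h
    rw [min_eq_left (hi i h).2]
    exact hprod _ _ (hi i h)
  have hHb := hprod βTH vH hH
  have hNb := hprod (-(1 - τT * βTN)) vN hN
  rw [abs_neg] at hNb
  have hS0 : 0 ≤ ∑ i ∈ 𝒩T, |βT i| := Finset.sum_nonneg fun i _ => abs_nonneg _
  have hα0 : 0 ≤ αT := le_trans (by positivity) hα
  have hα2 : (|1 - τT * βTN| + τT * (∑ i ∈ 𝒩T, |βT i|) + τT * |βTH|) * vmax ≤ αT * sst :=
    (div_le_iff₀ hsst).mp hα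
  have hκ2 : vmax / (sgo - sst) * τT ≤ 1 := (le_div_iff₀ hτT).mp hκ
  rw [hV, min_eq_left hN.2, min_eq_left hH.2]
  generalize vmax / (sgo - sst) = κ at *
  have h1 : κ * τT * (sT - sst) ≤ 1 * (sT - sst) :=
    mul_le_mul_of_nonneg_right hκ2 (by linarith [hs.1])
  have h2 : sst ≤ τT * (vT - κ * (sT - sst)) := by linarith
  have h3 := mul_le_mul_of_nonneg_left h2 hα0
  have h4 := mul_le_mul_of_nonneg_left hsum hτT.le
  have h5 := mul_le_mul_of_nonneg_left hHb hτT.le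
  linarith
end

section
/- Key inequality in the proof of Theorem 2: let 0 < s_st < s_go, v_max > 0, κ = v_max/(s_go − s_st), and τ > 0 with κ·τ ≤ 1. Then for every s ∈ [s_st, s_go], κ·τ·(s − s_st) − s ≤ −s_st. Consequently, for any α ≥ 0 and any real numbers v_d, v_H, v_i (i ∈ 𝒩), v_T ∈ [0, v_max] with s = τ·v_H ∈ [s_st, s_go], the derivative of the safety function along the closed-loop dynamics satisfies the lower bound ḣ = (1 − τ·β_d)·(v_d − v_H) − α·(κ·τ·(s − s_st) − s) − τ·(Σ_{i∈𝒩} β_i·(v_i − v_H) + β_T·(v_T − v_H)) ≥ −|1 − τ·β_d|·v_max + α·s_st − τ·(Σ_{i∈𝒩} |β_i| + |β_T|)·v_max. -/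
/-- key inequality in the proof of Theorem 2. With
`κ = v_max/(s_go − s_st)` and `κ τ ≤ 1`, one has
`κ τ (s − s_st) − s ≤ −s_st` for all `s ∈ [s_st, s_go]`; consequently the stated
lower bound on the derivative of the safety function holds on the safety
boundary `s = τ v_H`. -/
theorem key_inequality_theorem2
    (sst sgo vmax κ τ : ℝ)
    (hsst : 0 < sst) (hss : sst < sgo) (hvmax : 0 < vmax)
    (hκ : κ = vmax / (sgo - sst)) (hτ : 0 < τ) (hκτ : κ * τ ≤ 1) :
    (∀ s ∈ Set.Icc sst sgo, κ * τ * (s - sst) - s ≤ -sst) ∧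
    (∀ (𝒩 : Finset ℕ) (α βd βT : ℝ) (β : ℕ → ℝ) (vd vH vT : ℝ) (vi : ℕ → ℝ),
      0 ≤ α →
      vd ∈ Set.Icc 0 vmax → vH ∈ Set.Icc 0 vmax → vT ∈ Set.Icc 0 vmax →
      (∀ i ∈ 𝒩, vi i ∈ Set.Icc 0 vmax) →
      τ * vH ∈ Set.Icc sst sgo →
      (1 - τ * βd) * (vd - vH) - α * (κ * τ * (τ * vH - sst) - τ * vH)
          - τ * ((∑ i ∈ 𝒩, β i * (vi i - vH)) + βT * (vT - vH))
        ≥ -|1 - τ * βd| * vmax + α * sst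
          - τ * ((∑ i ∈ 𝒩, |β i|) + |βT|) * vmax) := by
  have key : ∀ s ∈ Set.Icc sst sgo, κ * τ * (s - sst) - s ≤ -sst := by
    intro s hs
    have h := mul_le_mul_of_nonneg_right hκτ (sub_nonneg.mpr hs.1)
    linarith
  refine ⟨key, ?_⟩
  intro 𝒩 α βd βT β vd vH vT vi hα hd hH hT hi hs
  have hb : ∀ b v : ℝ, v ∈ Set.Icc 0 vmax → |b * (v - vH)| ≤ |b| * vmax := by
    intro b v hv
    rw [abs_mul]
    refine mul_le_mul_of_nonneg_left ?_ (abs_nonneg b)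
    rw [abs_le]
    constructor <;> linarith [hv.1, hv.2, hH.1, hH.2]
  have h1 := (abs_le.mp (hb (1 - τ * βd) vd hd)).1
  have h2 := mul_le_mul_of_nonneg_left (key _ hs) hα
  have h3 : ∑ i ∈ 𝒩, β i * (vi i - vH) ≤ (∑ i ∈ 𝒩, |β i|) * vmax := by
    rw [Finset.sum_mul]
    exact Finset.sum_le_sum fun i h => (abs_le.mp (hb (β i) (vi i) (hi i h))).2
  have h4 := (abs_le.mp (hb βT vT hT)).2
  have h5 := mul_le_mul_of_nonneg_left (add_le_add h3 h4) hτ.le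
  have h6 : τ * ((∑ i ∈ 𝒩, |β i|) + |βT|) * vmax
      = τ * ((∑ i ∈ 𝒩, |β i|) * vmax + |βT| * vmax) := by ring
  rw [h6]
  linarith
end
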